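/- A tree T belongs to G^cs if and only if T is a double star (a tree of diameter at most three). -/

import Mathlib

open SimpleGraph
open scoped Classical

variable {V : Type*} [Fintype V]

noncomputable def setWeight (w : V → ℝ) (A : Set V) : ℝ :=
  ∑ v : V, if v ∈ A then w v else 0

def IsComponentOf (G : SimpleGraph V) (S C : Set V) : Prop :=
  ∃ c : (G.induce S).ConnectedComponent,
    C = Subtype.val '' {x : ↥S | (G.induce S).connectedComponentMk x = c}

def Touches (G : SimpleGraph V) (C D : Set V) : Prop :=
  ∃ a ∈ C, ∃ b ∈ D, G.Adj a b

def IsSafeSet (G : SimpleGraph V) (w : V → ℝ) (S : Set V) : Prop :=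
  S.Nonempty ∧ S ≠ Set.univ ∧
    ∀ C D : Set V, IsComponentOf G S C → IsComponentOf G Sᶜ D → Touches G C D →
      setWeight w D ≤ setWeight w C

def IsConnSafeSet (G : SimpleGraph V) (w : V → ℝ) (S : Set V) : Prop :=
  IsSafeSet G w S ∧ (G.induce S).Connected

noncomputable def safeNumber (G : SimpleGraph V) (w : V → ℝ) : ℝ :=
  sInf (setWeight w '' {S | IsSafeSet G w S})

noncomputable def connSafeNumber (G : SimpleGraph V) (w : V → ℝ) : ℝ :=
  sInf (setWeight w '' {S | IsConnSafeSet G w S})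

def InGcs (G : SimpleGraph V) : Prop :=
  ∀ w : V → ℝ, (∀ v, 0 < w v) → safeNumber G w = connSafeNumber G w

set_option linter.unusedSectionVars false

theorem comp_exists (G : SimpleGraph V) {S : Set V} {v : V} (hv : v ∈ S) :
    ∃ C, IsComponentOf G S C ∧ v ∈ C :=
  ⟨_, ⟨(G.induce S).connectedComponentMk ⟨v, hv⟩, rfl⟩, ⟨⟨v, hv⟩, rfl, rfl⟩⟩

theorem comp_sub {G : SimpleGraph V} {S C : Set V} (h : IsComponentOf G S C) : C ⊆ S := by
  obtain ⟨c, rfl⟩ := h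
  rintro _ ⟨x, -, rfl⟩
  exact x.2

theorem comp_nonempty {G : SimpleGraph V} {S C : Set V} (h : IsComponentOf G S C) :
    ∃ v, v ∈ C := by
  obtain ⟨c, rfl⟩ := h
  obtain ⟨x, hx⟩ := c.exists_rep
  exact ⟨x, x, hx, rfl⟩

theorem comp_reach {G : SimpleGraph V} {S C : Set V} (h : IsComponentOf G S C) {p q : V}
    (hp : p ∈ C) (hq : q ∈ C) :
    ∃ (h1 : p ∈ S) (h2 : q ∈ S), (G.induce S).Reachable ⟨p, h1⟩ ⟨q, h2⟩ := by
  obtain ⟨c, rfl⟩ := h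
  obtain ⟨x, hx, rfl⟩ := hp
  obtain ⟨y, hy, rfl⟩ := hq
  refine ⟨x.2, y.2, ?_⟩
  exact ConnectedComponent.exact (hx.trans hy.symm)

theorem comp_of_reach {G : SimpleGraph V} {S C : Set V} (h : IsComponentOf G S C) {p q : V}
    (hp : p ∈ C) (h1 : p ∈ S) (h2 : q ∈ S)
    (hr : (G.induce S).Reachable ⟨p, h1⟩ ⟨q, h2⟩) : q ∈ C := by
  obtain ⟨c, rfl⟩ := h
  obtain ⟨x, hx, rfl⟩ := hp
  exact ⟨⟨q, h2⟩, (ConnectedComponent.sound hr).symm.trans hx, rfl⟩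

theorem comp_closed {G : SimpleGraph V} {S C : Set V} (h : IsComponentOf G S C) {p q : V}
    (hp : p ∈ C) (hq : q ∈ S) (ha : G.Adj p q) : q ∈ C :=
  comp_of_reach h hp (comp_sub h hp) hq (Adj.reachable (by simpa using ha))

theorem comp_min {G : SimpleGraph V} {S C : Set V} (h : IsComponentOf G S C) {K : Set V}
    (hK : ∀ p ∈ K, ∀ q ∈ S, G.Adj p q → q ∈ K) {p : V} (hp : p ∈ C) (hpK : p ∈ K) : C ⊆ K := by
  intro q hq
  obtain ⟨h1, h2, ⟨W⟩⟩ := comp_reach h hp hq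
  have key : ∀ (a b : S), (G.induce S).Walk a b → a.1 ∈ K → b.1 ∈ K := by
    intro a b W
    induction W with
    | nil => exact id
    | cons hadj _ ih => exact fun ha => ih (hK _ ha _ (Subtype.property _) (by simpa using hadj))
  exact key _ _ W hpK

theorem comp_conn {G : SimpleGraph V} {S C : Set V} (h : IsComponentOf G S C)
    (hc : (G.induce S).Connected) : C = S := by
  apply Set.Subset.antisymm (comp_sub h)
  intro q hq
  obtain ⟨p, hp⟩ := comp_nonempty h
  exact comp_of_reach h hp (comp_sub h hp) hq (hc.preconnected _ _)

theorem sw_mono {w : V → ℝ} (hw : ∀ v, 0 < w v) {A B : Set V} (h : A ⊆ B) :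
    setWeight w A ≤ setWeight w B := by
  unfold setWeight
  apply Finset.sum_le_sum
  intro v _
  have := hw v
  by_cases h1 : v ∈ A
  · simp [h1, h h1]
  · by_cases h2 : v ∈ B <;> simp [h1, h2, this.le]

theorem sw_union {w : V → ℝ} {A B : Set V} (h : ∀ v ∈ A, v ∉ B) :
    setWeight w (A ∪ B) = setWeight w A + setWeight w B := by
  unfold setWeight
  rw [← Finset.sum_add_distrib]
  apply Finset.sum_congr rfl
  intro v _
  by_cases h1 : v ∈ A
  · simp [h1, h v h1]
  · simp [h1]

theorem sw_single (w : V → ℝ) (a : V) : setWeight w {a} = w a := by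
  simp [setWeight]

theorem sw_insert_le {w : V → ℝ} (hw : ∀ v, 0 < w v) (a : V) (B : Set V) :
    setWeight w (insert a B) ≤ w a + setWeight w B := by
  by_cases h : a ∈ B
  · rw [Set.insert_eq_of_mem h]; linarith [hw a]
  · rw [← Set.singleton_union, sw_union (by simpa using h), sw_single]

theorem sw_ge {w : V → ℝ} (hw : ∀ v, 0 < w v) {a : V} {A : Set V} (h : a ∈ A) :
    w a ≤ setWeight w A := by
  rw [← sw_single w a]; exact sw_mono hw (by simpa using h)

theorem sw_ge2 {w : V → ℝ} (hw : ∀ v, 0 < w v) {a b : V} {A : Set V} (hab : a ≠ b)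
    (h : a ∈ A) (h' : b ∈ A) : w a + w b ≤ setWeight w A := by
  rw [← sw_single w a, ← sw_single w b, ← sw_union (by simpa using hab)]
  exact sw_mono hw (by intro v; simp; rintro (rfl | rfl) <;> assumption)

theorem acyc_mem {G : SimpleGraph V} (hG : G.IsAcyclic) {K : Set V} {p q : V}
    (h : ∃ (h1 : p ∈ K) (h2 : q ∈ K), (G.induce K).Reachable ⟨p, h1⟩ ⟨q, h2⟩)
    (P : G.Walk p q) (hP : P.IsPath) : ∀ m ∈ P.support, m ∈ K := by
  obtain ⟨h1, h2, ⟨W⟩⟩ := h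
  let f : G.induce K →g G := (Embedding.induce K).toHom
  have hQ := Walk.IsPath.map (f := f) Subtype.val_injective W.toPath.2
  have := hG.path_unique ⟨P, hP⟩ ⟨_, hQ⟩
  intro m hm
  have e : P = (W.toPath.1.map f) := congrArg Subtype.val this
  have hm' : m ∈ (W.toPath.1.map f).support := by
    have e2 := congrArg Walk.support e
    exact e2 ▸ hm
  have hm2 := (List.mem_map.1 ((Walk.support_map f W.toPath.1) ▸ hm'))
  obtain ⟨x, -, rfl⟩ := hm2
  exact x.2

theorem connsafe_of {G : SimpleGraph V} {w : V → ℝ} {S : Set V}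
    (hc : (G.induce S).Connected) (hne : S ≠ Set.univ)
    (h : ∀ D, IsComponentOf G Sᶜ D → setWeight w D ≤ setWeight w S) : IsConnSafeSet G w S := by
  refine ⟨⟨?_, hne, ?_⟩, hc⟩
  · obtain ⟨x⟩ := hc.nonempty
    exact ⟨x, x.2⟩
  · intro C D hC hD _
    rw [comp_conn hC hc]; exact h D hD

theorem attained {ι : Type*} [Finite ι] (f : Set ι → ℝ) (P : Set (Set ι)) (h : P.Nonempty) :
    ∃ S ∈ P, sInf (f '' P) = f S ∧ ∀ T ∈ P, f S ≤ f T := by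
  have hf : P.Finite := Set.toFinite P
  obtain ⟨S, hS, hmin⟩ := Set.exists_min_image P f hf h
  refine ⟨S, hS, ?_, hmin⟩
  apply IsLeast.csInf_eq
  exact ⟨⟨S, hS, rfl⟩, by rintro _ ⟨T, hT, rfl⟩; exact hmin T hT⟩

/-- the graph being connected, any component outside a connected set touches it -/
theorem touch_of {G : SimpleGraph V} (hG : G.Connected) {S D : Set V} (hS : S.Nonempty)
    (hD : IsComponentOf G Sᶜ D) : ∃ a ∈ S, ∃ b ∈ D, G.Adj a b := by
  by_contra hcon
  push Not at hcon
  obtain ⟨s, hs⟩ := hS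
  obtain ⟨d, hd⟩ := comp_nonempty hD
  obtain ⟨W⟩ := hG.preconnected d s
  have key : ∀ (a b : V), G.Walk a b → a ∈ D → b ∈ D := by
    intro a b W
    induction W with
    | nil => exact id
    | cons hadj _ ih =>
      refine fun ha => ih (comp_closed hD ha ?_ hadj)
      intro hu
      exact hcon _ hu _ ha hadj.symm
  exact comp_sub hD (key _ _ W hd) hs

theorem sw_add (f g : V → ℝ) (A : Set V) :
    setWeight (fun v => f v + g v) A = setWeight f A + setWeight g A := by
  unfold setWeight
  rw [← Finset.sum_add_distrib]
  apply Finset.sum_congr rfl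
  intro v _
  by_cases h1 : v ∈ A <;> simp [h1]

theorem sw_ind (a : V) (r : ℝ) (A : Set V) :
    setWeight (fun v => if v = a then r else 0) A = if a ∈ A then r else 0 := by
  unfold setWeight
  rw [Finset.sum_eq_single a]
  · simp
  · intro b _ hb; simp [hb]
  · simp

theorem exists_path5 {G : SimpleGraph V} {u v : V} (P : G.Walk u v) (hP : P.IsPath)
    (hl : 4 ≤ P.length) :
    ∃ a b c d e : V, G.Adj a b ∧ G.Adj b c ∧ G.Adj c d ∧ G.Adj d e ∧
      [a, b, c, d, e].Nodup := by
  match P, hP, hl with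
  | .cons (v := b) h1 (.cons (v := c) h2 (.cons (v := d) h3 (.cons (v := e) h4 q))), hP, _ =>
    refine ⟨u, b, c, d, e, h1, h2, h3, h4, ?_⟩
    have hn := hP.support_nodup
    have : e ∈ q.support := q.start_mem_support
    simp only [Walk.support_cons, List.nodup_cons, List.mem_cons] at hn ⊢
    grind
  | .nil, _, hl => simp at hl
  | .cons h1 .nil, _, hl => simp at hl
  | .cons h1 (.cons h2 .nil), _, hl => simp at hl
  | .cons h1 (.cons h2 (.cons h3 .nil)), _, hl => simp at hl

theorem forward (G : SimpleGraph V) (hT : G.IsTree) (hI : InGcs G) (u v : V) :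
    G.dist u v ≤ 3 := by
  by_contra hcon
  push Not at hcon
  obtain ⟨P, hP, hPl⟩ := hT.connected.exists_path_of_dist u v
  obtain ⟨a, b, c, d, e, hab, hbc, hcd, hde, hn⟩ := exists_path5 P hP (by omega)
  simp only [List.nodup_cons, List.mem_cons, List.not_mem_nil, not_or, not_false_eq_true,
    or_false, and_true, List.nodup_nil] at hn
  obtain ⟨⟨nab, nac, nad, nae⟩, ⟨nbc, nbd, nbe⟩, ⟨ncd, nce⟩, nde⟩ := hn
  -- convexity
  have R3 : ∀ {K : Set V} {p m q : V}, G.Adj p m → G.Adj m q → p ≠ q →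
      (∃ (h1 : p ∈ K) (h2 : q ∈ K), (G.induce K).Reachable ⟨p, h1⟩ ⟨q, h2⟩) → m ∈ K := by
    intro K p m q h1 h2 hne hr
    refine acyc_mem hT.isAcyclic hr (.cons h1 (.cons h2 .nil)) ?_ m (by simp)
    simp [Walk.cons_isPath_iff, h1.ne, h2.ne, hne]
  have R4 : ∀ {K : Set V} {p m m' q : V}, G.Adj p m → G.Adj m m' → G.Adj m' q → p ≠ q →
      p ≠ m' → m ≠ q →
      (∃ (h1 : p ∈ K) (h2 : q ∈ K), (G.induce K).Reachable ⟨p, h1⟩ ⟨q, h2⟩) → m ∈ K ∧ m' ∈ K := by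
    intro K p m m' q h1 h2 h3 n1 n2 n3 hr
    have := acyc_mem hT.isAcyclic hr (.cons h1 (.cons h2 (.cons h3 .nil)))
      (by simp [Walk.cons_isPath_iff, h1.ne, h2.ne, h3.ne, n1, n2, n3])
    exact ⟨this m (by simp), this m' (by simp)⟩
  have R5 : ∀ {K : Set V}, (∃ (h1 : a ∈ K) (h2 : e ∈ K),
      (G.induce K).Reachable ⟨a, h1⟩ ⟨e, h2⟩) → b ∈ K ∧ c ∈ K ∧ d ∈ K := by
    intro K hr
    have := acyc_mem hT.isAcyclic hr (.cons hab (.cons hbc (.cons hcd (.cons hde .nil))))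
      (by simp [Walk.cons_isPath_iff, *])
    exact ⟨this b (by simp), this c (by simp), this d (by simp)⟩
  haveI : Nonempty V := ⟨a⟩
  have hcard : (0 : ℝ) < Fintype.card V := by exact_mod_cast Fintype.card_pos
  let r : V → ℝ := fun _ => 1 / (2 * Fintype.card V)
  have hr : ∀ v, 0 < r v := fun v => by positivity
  have hr1 : ∀ A, setWeight r A ≤ 1 / 2 := by
    intro A
    refine (sw_mono hr (Set.subset_univ A)).trans ?_
    simp only [setWeight, Set.mem_univ, if_true, r, Finset.sum_const, Finset.card_univ,
      nsmul_eq_mul]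
    apply le_of_eq
    field_simp
  have hr0 : ∀ A, 0 ≤ setWeight r A := by
    intro A
    refine le_trans (le_of_eq ?_) (sw_mono hr (Set.empty_subset A))
    simp [setWeight]
  let w : V → ℝ := fun v => (if v = a then 4 else 0) + ((if v = b then 5 else 0) +
    ((if v = c then 2 else 0) + ((if v = d then 5 else 0) + ((if v = e then 4 else 0) + r v))))
  have hw : ∀ v, 0 < w v := by
    intro v
    have := hr v
    simp only [w]
    positivity
  have hwA : ∀ A, setWeight w A = (if a ∈ A then 4 else 0) + ((if b ∈ A then 5 else 0) +
    ((if c ∈ A then 2 else 0) + ((if d ∈ A then 5 else 0) + ((if e ∈ A then 4 else 0) +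
      setWeight r A)))) := by
    intro A
    simp only [w, sw_add, sw_ind]
  have hS0 : IsSafeSet G w {b, d} := by
    refine ⟨⟨b, by simp⟩, ?_, ?_⟩
    · intro h
      have : a ∈ ({b, d} : Set V) := h ▸ Set.mem_univ a
      simp [nab, nad] at this
    · intro C D hC hD _
      have h5 : 5 ≤ setWeight w C := by
        obtain ⟨p, hp⟩ := comp_nonempty hC
        have := sw_ge hw hp
        have h0 := hr p
        rcases comp_sub hC hp with rfl | rfl
        · refine le_trans ?_ this
          simp [w, nbc, nbd, nbe, Ne.symm nab]; linarith
        · refine le_trans ?_ this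
          simp [w, nde, Ne.symm ncd, Ne.symm nad, Ne.symm nbd]; linarith
      have hb : b ∉ D := fun h => comp_sub hD h (by simp)
      have hd : d ∉ D := fun h => comp_sub hD h (by simp)
      have k1 : ¬ (a ∈ D ∧ c ∈ D) := fun h => by
        have := R3 hab hbc nac (comp_reach hD h.1 h.2)
        simp at this
      have k2 : ¬ (c ∈ D ∧ e ∈ D) := fun h => by
        have := R3 hcd hde nce (comp_reach hD h.1 h.2)
        simp at this
      have k3 : ¬ (a ∈ D ∧ e ∈ D) := fun h => by
        have := R5 (comp_reach hD h.1 h.2)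
        simp at this
      have := hr1 D
      refine le_trans ?_ h5
      rw [hwA D]
      by_cases ha : a ∈ D <;> by_cases hc : c ∈ D <;> by_cases he : e ∈ D <;>
        simp only [ha, hb, hc, hd, he, if_true, if_false, and_self, not_true_eq_false] at k1 k2 k3 ⊢ <;>
        linarith
  have hS0w : setWeight w {b, d} ≤ 21 / 2 := by
    rw [hwA]
    have := hr1 {b, d}
    simp only [Set.mem_insert_iff, Set.mem_singleton_iff, nab, nad, Ne.symm nbc, ncd,
      Ne.symm nbe, Ne.symm nde, or_self, if_false, true_or, or_true, if_true]
    linarith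
  have hconn : ∀ S, IsConnSafeSet G w S → 11 ≤ setWeight w S := by
    rintro S ⟨⟨hne, -, hs⟩, hc⟩
    have hD : ∀ D, IsComponentOf G Sᶜ D → setWeight w D ≤ setWeight w S := by
      intro D hD
      obtain ⟨p, hp⟩ := hne
      obtain ⟨C, hC, -⟩ := comp_exists G hp
      have e1 := comp_conn hC hc
      subst e1
      exact hs _ D hC hD (touch_of hT.connected ⟨p, hp⟩ hD)
    have reach : ∀ {p q}, p ∈ S → q ∈ S → (∃ (h1 : p ∈ S) (h2 : q ∈ S),
      (G.induce S).Reachable ⟨p, h1⟩ ⟨q, h2⟩) := fun h1 h2 => ⟨h1, h2, hc.preconnected _ _⟩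
    have ac := fun h1 h2 => R3 hab hbc nac (reach h1 h2)
    have bd := fun h1 h2 => R3 hbc hcd nbd (reach h1 h2)
    have ce := fun h1 h2 => R3 hcd hde nce (reach h1 h2)
    have ad := fun h1 h2 => R4 hab hbc hcd nad nac nbd (reach h1 h2)
    have be := fun h1 h2 => R4 hbc hcd hde nbe nbd nce (reach h1 h2)
    have ae := fun h1 h2 => R5 (reach h1 h2)
    -- heavy pieces of the complement
    have X1 : c ∉ S → d ∉ S → e ∉ S → 11 ≤ setWeight w S := by
      intro hc hd he
      obtain ⟨D, hD1, hcD⟩ := comp_exists G (S := Sᶜ) hc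
      have hdD := comp_closed hD1 hcD hd hcd
      have heD := comp_closed hD1 hdD he hde
      refine le_trans ?_ (hD D hD1)
      rw [hwA]
      simp only [hcD, hdD, heD, if_true]
      have := hr0 D
      split_ifs <;> linarith
    have X2 : a ∉ S → b ∉ S → c ∉ S → 11 ≤ setWeight w S := by
      intro ha hb hc
      obtain ⟨D, hD1, hcD⟩ := comp_exists G (S := Sᶜ) hc
      have hdD := comp_closed hD1 hcD hb hbc.symm
      have heD := comp_closed hD1 hdD ha hab.symm
      refine le_trans ?_ (hD D hD1)
      rw [hwA]
      simp only [hcD, hdD, heD, if_true]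
      have := hr0 D
      split_ifs <;> linarith
    have X3 : d ∉ S → e ∉ S → 9 ≤ setWeight w S := by
      intro hd he
      obtain ⟨D, hD1, hdD⟩ := comp_exists G (S := Sᶜ) hd
      have heD := comp_closed hD1 hdD he hde
      refine le_trans ?_ (hD D hD1)
      rw [hwA]
      simp only [hdD, heD, if_true]
      have := hr0 D
      split_ifs <;> linarith
    have X4 : a ∉ S → b ∉ S → 9 ≤ setWeight w S := by
      intro ha hb
      obtain ⟨D, hD1, hdD⟩ := comp_exists G (S := Sᶜ) hb
      have heD := comp_closed hD1 hdD ha hab.symm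
      refine le_trans ?_ (hD D hD1)
      rw [hwA]
      simp only [hdD, heD, if_true]
      have := hr0 D
      split_ifs <;> linarith
    have l0 := hr0 S
    have l1 := hr1 S
    rw [hwA] at X1 X2 X3 X4 ⊢
    clear hs hD reach hwA hS0w hS0 hw
    by_cases ha : a ∈ S <;> by_cases hb : b ∈ S <;> by_cases hc : c ∈ S <;>
      by_cases hd : d ∈ S <;> by_cases he : e ∈ S <;>
      simp only [ha, hb, hc, hd, he, if_true, if_false, not_true_eq_false, not_false_eq_true,
        forall_true_left, false_implies, true_implies, and_false, false_and, and_self,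
        imp_false, implies_true] at ac bd ce ad be ae X1 X2 X3 X4 ⊢ <;>
      first | linarith | (exact absurd X3 (by linarith)) | (exact absurd X4 (by linarith))
  have := hI w hw
  obtain ⟨S, hS, hSe, hSm⟩ := attained (setWeight w) {S | IsSafeSet G w S} ⟨_, hS0⟩
  have hle := hSm _ hS0
  rw [safeNumber, hSe, connSafeNumber] at this
  by_cases hcs : {S | IsConnSafeSet G w S}.Nonempty
  · obtain ⟨T, hT', hTe, -⟩ := attained (setWeight w) _ hcs
    have := hconn T hT'
    linarith
  · rw [Set.not_nonempty_iff_eq_empty] at hcs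
    rw [hcs, Set.image_empty, Real.sInf_empty] at this
    obtain ⟨p, hp⟩ := hS.1
    have := sw_ge hw hp
    have := hw p
    linarith

def DS (G : SimpleGraph V) (x y : V) : Prop :=
  G.Adj x y ∧ ∀ v, v ≠ x → v ≠ y → (∀ u, G.Adj v u ↔ u = x) ∨ (∀ u, G.Adj v u ↔ u = y)

theorem DS.symm {G : SimpleGraph V} {x y : V} (h : DS G x y) : DS G y x :=
  ⟨h.1.symm, fun v h1 h2 => (h.2 v h2 h1).symm⟩

theorem dist_path {G : SimpleGraph V} (hT : G.IsTree) {u v : V} (P : G.Walk u v)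
    (hP : P.IsPath) : G.dist u v = P.length := by
  obtain ⟨Q, hQ, hl⟩ := hT.connected.exists_path_of_dist u v
  have : (⟨Q, hQ⟩ : G.Path u v) = ⟨P, hP⟩ := hT.isAcyclic.path_unique _ _
  have e : Q = P := congrArg Subtype.val this
  rw [← hl, e]

theorem ds_exists [Nontrivial V] (G : SimpleGraph V) (hT : G.IsTree)
    (hd : ∀ u v, G.dist u v ≤ 3) : ∃ x y, DS G x y := by
  obtain ⟨p0, ⟨hp0, hmax⟩⟩ : ∃ p : V × V, G.Adj p.1 p.2 ∧ ∀ q : V × V, G.Adj q.1 q.2 →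
      (G.neighborSet q.1).ncard + (G.neighborSet q.2).ncard ≤
      (G.neighborSet p.1).ncard + (G.neighborSet p.2).ncard := by
    have hne : {p : V × V | G.Adj p.1 p.2}.Nonempty := by
      obtain ⟨a⟩ := hT.connected.nonempty
      obtain ⟨b, hb⟩ := hT.connected.preconnected.exists_adj_of_nontrivial a
      exact ⟨(a, b), hb⟩
    obtain ⟨p, hp, h⟩ := Set.exists_max_image {p : V × V | G.Adj p.1 p.2}
      (fun q => (G.neighborSet q.1).ncard + (G.neighborSet q.2).ncard) (Set.toFinite _) hne
    exact ⟨p, hp, h⟩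
  obtain ⟨x, y⟩ := p0
  simp only at hp0 hmax
  have key : ∀ x y, G.Adj x y → (∀ q : V × V, G.Adj q.1 q.2 →
      (G.neighborSet q.1).ncard + (G.neighborSet q.2).ncard ≤
      (G.neighborSet x).ncard + (G.neighborSet y).ncard) →
      ∀ z, G.Adj z x → z ≠ y → ∀ u, G.Adj z u → u = x := by
    intro x y hxy hmax z hzx hzy u hzu
    by_contra hux
    by_cases ht : ∃ t, G.Adj y t ∧ t ≠ x
    · obtain ⟨t, hyt, htx⟩ := ht
      let P : G.Walk u t := .cons hzu.symm (.cons hzx (.cons hxy (.cons hyt .nil)))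
      have hP : P.IsPath := by
        rw [hT.isAcyclic.isPath_iff_isChain]
        have := hzu.ne; have := hzx.ne; have := hxy.ne; have := hyt.ne
        simp [P, List.isChain_cons]
        grind
      have := dist_path hT P hP
      have h3 := hd u t
      simp [P] at this
      omega
    · push Not at ht
      have h1 : (G.neighborSet y).ncard ≤ 1 := by
        rw [← Set.ncard_singleton x]
        exact Set.ncard_le_ncard (fun t h => ht t h) (Set.toFinite _)
      have h2 : 2 ≤ (G.neighborSet z).ncard := by
        rw [← Set.ncard_pair hux]
        refine Set.ncard_le_ncard ?_ (Set.toFinite _)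
        rintro t (rfl | rfl)
        · exact hzu
        · exact hzx
      have := hmax (x, z) hzx.symm
      simp only at this
      omega
  have k1 := key x y hp0 hmax
  have k2 := key y x hp0.symm (fun q hq => by rw [add_comm (G.neighborSet y).ncard]; exact hmax q hq)
  have dom : ∀ v, v = x ∨ v = y ∨ G.Adj v x ∨ G.Adj v y := by
    intro v
    obtain ⟨W⟩ := hT.connected.preconnected x v
    have : ∀ (a b : V), G.Walk a b → (a = x ∨ a = y ∨ G.Adj a x ∨ G.Adj a y) →
        (b = x ∨ b = y ∨ G.Adj b x ∨ G.Adj b y) := by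
      intro a b W
      induction W with
      | nil => exact id
      | cons hadj _ ih =>
        rename_i p q _ _
        intro h
        apply ih
        by_cases hpx : p = x
        · subst hpx; exact Or.inr (Or.inr (Or.inl hadj.symm))
        by_cases hpy : p = y
        · subst hpy; exact Or.inr (Or.inr (Or.inr hadj.symm))
        rcases h with h | h | h | h
        · exact absurd h hpx
        · exact absurd h hpy
        · exact Or.inl (k1 p h hpy q hadj)
        · exact Or.inr (Or.inl (k2 p h hpx q hadj))
    exact this _ _ W (Or.inl rfl)
  refine ⟨x, y, hp0, fun v hx hy => ?_⟩
  rcases dom v with h | h | h | h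
  · exact absurd h hx
  · exact absurd h hy
  · exact Or.inl fun u => ⟨k1 v h hy u, fun e => e ▸ h⟩
  · exact Or.inr fun u => ⟨k2 v h hx u, fun e => e ▸ h⟩

theorem conn_both {G : SimpleGraph V} {x y : V} (h : DS G x y) {S : Set V} (hx : x ∈ S)
    (hy : y ∈ S) : (G.induce S).Connected := by
  have hxy : (G.induce S).Reachable ⟨y, hy⟩ ⟨x, hx⟩ :=
    Adj.reachable (by simpa using h.1.symm)
  have key : ∀ v : S, (G.induce S).Reachable v ⟨x, hx⟩ := by
    rintro ⟨v, hv⟩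
    by_cases h1 : v = x
    · subst h1; exact Reachable.refl _
    by_cases h2 : v = y
    · subst h2; exact hxy
    rcases h.2 v h1 h2 with h3 | h3
    · exact Adj.reachable (by simpa using (h3 x).2 rfl)
    · exact (Adj.reachable (by simpa using (h3 y).2 rfl)).trans hxy
  haveI : Nonempty S := ⟨⟨x, hx⟩⟩
  exact Connected.mk fun u v => (key u).trans (key v).symm

theorem safe_both {G : SimpleGraph V} {x y : V} (h : DS G x y) {w : V → ℝ}
    (hw : ∀ v, 0 < w v) {S : Set V} (hx : x ∈ S)
    (hy : y ∈ S) (hne : S ≠ Set.univ) (hl : ∀ l, l ∉ S → w l ≤ setWeight w S) :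
    IsConnSafeSet G w S := by
  refine connsafe_of (conn_both h hx hy) hne fun D hD => ?_
  obtain ⟨l, hlD⟩ := comp_nonempty hD
  have hlS : l ∉ S := comp_sub hD hlD
  refine le_trans ?_ (hl l hlS)
  rw [← sw_single w l]
  refine sw_mono hw (comp_min hD ?_ hlD rfl)
  rintro p rfl q hq hpq
  exfalso
  rcases h.2 p (fun e => hlS (e ▸ hx)) (fun e => hlS (e ▸ hy)) with h3 | h3
  · exact hq ((h3 q).1 hpq ▸ hx)
  · exact hq ((h3 q).1 hpq ▸ hy)

theorem case_none {G : SimpleGraph V} {x y : V} (h : DS G x y) {w : V → ℝ}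
    (hw : ∀ v, 0 < w v) {S : Set V} (hS : IsSafeSet G w S) (hx : x ∉ S) (hy : y ∉ S) :
    ∃ T, IsConnSafeSet G w T ∧ setWeight w T ≤ setWeight w S := by
  by_cases hsub : S.Subsingleton
  · refine ⟨S, ⟨hS, ?_⟩, le_rfl⟩
    haveI : Nonempty S := hS.1.to_subtype
    haveI : Subsingleton S := hsub.coe_sort
    exact Connected.mk fun u v => by rw [Subsingleton.elim u v]
  obtain ⟨m, hm, hmax⟩ := Set.exists_max_image S w (Set.toFinite _) hS.1
  obtain ⟨m', hm', hmm⟩ : ∃ m' ∈ S, m' ≠ m := by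
    by_contra hcon
    push Not at hcon
    exact hsub fun p hp q hq => (hcon p hp).trans (hcon q hq).symm
  obtain ⟨D, hD, hxD⟩ := comp_exists G (S := Sᶜ) hx
  have hyD : y ∈ D := comp_closed hD hxD hy h.1
  have hleaf : ∀ l ∈ S, setWeight w D ≤ w l := by
    intro l hl
    obtain ⟨C, hC, hlC⟩ := comp_exists G hl
    have hCl : C ⊆ {l} := by
      refine comp_min hC ?_ hlC rfl
      rintro p rfl q hq hpq
      exfalso
      rcases h.2 p (fun e => hx (e ▸ hl)) (fun e => hy (e ▸ hl)) with h3 | h3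
      · exact hx ((h3 q).1 hpq ▸ hq)
      · exact hy ((h3 q).1 hpq ▸ hq)
    have h1 : setWeight w D ≤ setWeight w C := by
      refine hS.2.2 C D hC hD ?_
      rcases h.2 l (fun e => hx (e ▸ hl)) (fun e => hy (e ▸ hl)) with h3 | h3
      · exact ⟨l, hlC, x, hxD, (h3 x).2 rfl⟩
      · exact ⟨l, hlC, y, hyD, (h3 y).2 rfl⟩
    have h2 := sw_mono hw hCl
    rw [sw_single] at h2
    linarith
  have hmT : w m ≤ setWeight w {m, x, y} := sw_ge hw (by simp)
  refine ⟨{m, x, y}, safe_both h hw (by simp) (by simp) ?_ ?_, ?_⟩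
  · intro he
    have : m' ∈ ({m, x, y} : Set V) := he ▸ Set.mem_univ m'
    rcases this with e | e | e
    · exact hmm e
    · exact hx (e ▸ hm')
    · exact hy (e ▸ hm')
  · intro l hl
    refine le_trans ?_ hmT
    by_cases hlS : l ∈ S
    · exact hmax l hlS
    · refine le_trans (sw_ge hw ?_) (hleaf m hm)
      simp only [Set.mem_insert_iff, Set.mem_singleton_iff, not_or] at hl
      rcases h.2 l hl.2.1 hl.2.2 with h3 | h3
      · exact comp_closed hD hxD hlS ((h3 x).2 rfl).symm
      · exact comp_closed hD hyD hlS ((h3 y).2 rfl).symm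
  · have h1 := sw_insert_le hw m {x, y}
    have h2 : setWeight w {x, y} ≤ setWeight w D :=
      sw_mono hw (by rintro t (rfl | rfl) <;> assumption)
    have h3 := hleaf m' hm'
    have h4 := sw_ge2 hw hmm hm' hm
    linarith

theorem case_one {G : SimpleGraph V} {x y : V} (h : DS G x y) {w : V → ℝ}
    (hw : ∀ v, 0 < w v) {S : Set V} (hS : IsSafeSet G w S) (hx : x ∈ S) (hy : y ∉ S) :
    ∃ T, IsConnSafeSet G w T ∧ setWeight w T ≤ setWeight w S := by
  obtain ⟨C, hC, hxC⟩ := comp_exists G hx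
  obtain ⟨D, hD, hyD⟩ := comp_exists G (S := Sᶜ) hy
  have hCS := comp_sub hC
  by_cases hB : S ⊆ C
  · refine ⟨S, ⟨hS, ?_⟩, le_rfl⟩
    haveI : Nonempty S := hS.1.to_subtype
    refine Connected.mk fun u v => ?_
    obtain ⟨_, _, hr⟩ := comp_reach hC (hB u.2) (hB v.2)
    exact hr
  have hleaf : ∀ v ∈ S, v ∉ C → ∀ u, G.Adj v u ↔ u = y := by
    intro v hv hvC
    rcases h.2 v (fun e => hvC (e ▸ hxC)) (fun e => hy (e ▸ hv)) with h3 | h3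
    · exact absurd (comp_closed hC hxC hv ((h3 x).2 rfl).symm) hvC
    · exact h3
  obtain ⟨b, ⟨hbS, hbC⟩, hM⟩ := Set.exists_max_image (S \ C) w (Set.toFinite _)
    (Set.diff_nonempty.2 hB)
  have hDC : setWeight w D ≤ setWeight w C := hS.2.2 C D hC hD ⟨x, hxC, y, hyD, h.1⟩
  have hDb : setWeight w D ≤ w b := by
    obtain ⟨E, hE, hbE⟩ := comp_exists G hbS
    have hEb : E ⊆ {b} := by
      refine comp_min hE ?_ hbE rfl
      rintro p rfl q hq hpq
      exact absurd ((hleaf p hbS hbC q).1 hpq ▸ hq) hy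
    have h1 := hS.2.2 E D hE hD ⟨b, hbE, y, hyD, (hleaf b hbS hbC y).2 rfl⟩
    have h2 := sw_mono hw hEb
    rw [sw_single] at h2
    linarith
  have hout : ∀ v, v ∉ S → w v ≤ setWeight w C := by
    intro v hv
    by_cases hvy : v = y
    · exact (sw_ge hw (hvy ▸ hyD)).trans hDC
    rcases h.2 v (fun e => hv (e ▸ hx)) hvy with h3 | h3
    · obtain ⟨E, hE, hvE⟩ := comp_exists G (S := Sᶜ) hv
      exact (sw_ge hw hvE).trans (hS.2.2 C E hC hE ⟨x, hxC, v, hvE, ((h3 x).2 rfl).symm⟩)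
    · exact (sw_ge hw (comp_closed hD hyD hv ((h3 y).2 rfl).symm)).trans hDC
  have hCb : setWeight w C + w b ≤ setWeight w S := by
    rw [← sw_single w b, ← sw_union (by rintro v hv rfl; exact hbC hv)]
    exact sw_mono hw (Set.union_subset hCS (by simpa using hbS))
  have hyw : w y ≤ setWeight w D := sw_ge hw hyD
  by_cases hF : {T : Set V | insert y C ⊆ T ∧ (∀ v ∈ T, v ∈ S → v ∈ C) ∧
      w b ≤ setWeight w T}.Nonempty
  · obtain ⟨T, ⟨hT1, hT2, hT3⟩, -, hmin⟩ := attained (setWeight w) _ hF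
    have hCT : C ⊆ T := (Set.subset_insert _ _).trans hT1
    refine ⟨T, safe_both h hw (hCT hxC) (hT1 (Set.mem_insert _ _)) ?_ ?_, ?_⟩
    · intro e
      exact hbC (hT2 b (e ▸ Set.mem_univ b) hbS)
    · intro l hl
      by_cases hlS : l ∈ S
      · exact (hM l ⟨hlS, fun hc => hl (hCT hc)⟩).trans hT3
      · exact (hout l hlS).trans (sw_mono hw hCT)
    · by_cases hsub : T ⊆ insert y C
      · have h1 := sw_mono hw hsub
        have h2 := sw_insert_le hw y C
        linarith
      · obtain ⟨l, hlT, hl⟩ := Set.not_subset.1 hsub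
        have hlS : l ∉ S := fun hs => hl (Or.inr (hT2 l hlT hs))
        have e1 : setWeight w T = w l + setWeight w (T \ {l}) := by
          rw [← sw_single w l, ← sw_union (by simp)]
          congr 1
          ext v; simp; grind
        have h1 : setWeight w (T \ {l}) < w b := by
          by_contra hcon
          push Not at hcon
          have := hmin (T \ {l}) ⟨fun v hv => ⟨hT1 hv, fun e => hl (e ▸ hv)⟩,
            fun v hv => hT2 v hv.1, hcon⟩
          linarith [hw l]
        have := hout l hlS
        linarith
  · have hT0 : setWeight w {v | v ∈ S → v ∈ C} < w b := by
      by_contra hcon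
      push Not at hcon
      refine hF ⟨{v | v ∈ S → v ∈ C}, ?_, fun v hv => hv, hcon⟩
      rintro v (rfl | hv)
      · exact fun hs => absurd hs hy
      · exact fun _ => hv
    have hby : b ≠ y := fun e => hy (e ▸ hbS)
    have hadj : G.Adj b y := (hleaf b hbS hbC y).2 rfl
    have hbT : w b ≤ setWeight w {b, y} := sw_ge hw (by simp)
    refine ⟨{b, y}, connsafe_of ?_ ?_ ?_, ?_⟩
    · exact induce_pair_connected_of_adj hadj
    · intro e
      have : x ∈ ({b, y} : Set V) := e ▸ Set.mem_univ x
      rcases this with e | e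
      · exact hbC (e ▸ hxC)
      · exact hy (e ▸ hx)
    · intro E hE
      refine le_trans ?_ hbT
      obtain ⟨p, hp⟩ := comp_nonempty hE
      by_cases hpK : p ∈ S → p ∈ C
      · refine le_trans (sw_mono hw ?_) hT0.le
        have hpy : p ≠ y := fun e => comp_sub hE hp (by simp [e])
        refine (comp_min hE (K := {v | v ∈ S → v ∈ C} \ {y}) ?_ hp ⟨hpK, hpy⟩).trans
          Set.diff_subset
        rintro s ⟨hs, hsy⟩ t ht hst
        have hty : t ≠ y := fun e => ht (by simp [e])
        refine ⟨fun htS => ?_, hty⟩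
        by_contra htC
        exact hsy ((hleaf t htS htC s).1 hst.symm)
      · push Not at hpK
        refine le_trans ?_ (hM p hpK)
        rw [← sw_single w p]
        refine sw_mono hw (comp_min hE ?_ hp rfl)
        rintro s rfl t ht hst
        exact absurd (by simp [(hleaf s hpK.1 hpK.2 t).1 hst]) ht
    · have h1 := sw_insert_le hw b {y}
      rw [sw_single] at h1
      linarith

theorem backward (G : SimpleGraph V) (hT : G.IsTree) (hd : ∀ u v, G.dist u v ≤ 3) :
    InGcs G := by
  intro w hw
  have key : ∀ S, IsSafeSet G w S → ∃ T, IsConnSafeSet G w T ∧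
      setWeight w T ≤ setWeight w S := by
    intro S hS
    haveI : Nontrivial V := by
      obtain ⟨p, hp⟩ := hS.1
      obtain ⟨q, hq⟩ := (Set.ne_univ_iff_exists_notMem _).1 hS.2.1
      exact ⟨p, q, fun e => hq (e ▸ hp)⟩
    obtain ⟨x, y, h⟩ := ds_exists G hT hd
    by_cases hx : x ∈ S <;> by_cases hy : y ∈ S
    · exact ⟨S, ⟨hS, conn_both h hx hy⟩, le_rfl⟩
    · exact case_one h hw hS hx hy
    · exact case_one h.symm hw hS hy hx
    · exact case_none h hw hS hx hy
  unfold safeNumber connSafeNumber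
  by_cases hne : {S | IsSafeSet G w S}.Nonempty
  · obtain ⟨S, hS, e1, h1⟩ := attained (setWeight w) _ hne
    obtain ⟨T, hT, hle⟩ := key S hS
    obtain ⟨U, hU, e2, h2⟩ := attained (setWeight w) {S | IsConnSafeSet G w S} ⟨T, hT⟩
    rw [e1, e2]
    exact le_antisymm (h1 U hU.1) ((h2 T hT).trans hle)
  · have h2 : {S | IsConnSafeSet G w S} = ∅ := by
      rw [← Set.not_nonempty_iff_eq_empty]
      rintro ⟨S, hS⟩
      exact hne ⟨S, hS.1⟩
    rw [Set.not_nonempty_iff_eq_empty] at hne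
    rw [hne, h2]

theorem stmt_15 (G : SimpleGraph V) (hT : G.IsTree) :
    InGcs G ↔ ∀ u v : V, G.dist u v ≤ 3 :=
  ⟨fun h u v => forward G hT h u v, backward G hT⟩
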